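/- arXiv:2604.01143 — 2 statements merged into one kernel-verified Lean document; each statement's English description precedes it below -/
import Mathlib

section
/- For every k ≥ 0 and every n ≥ k + 3, the number of permutations of length n with exactly k inversions that avoid both 1324 and 1243 equals p(k), the number of integer partitions of k. -/
/-- A permutation `π` of length `n` (as a bijection of `Fin n`, position `i` has value `π i`)
contains the pattern `p` of length `m` if some subsequence of `π` is order-isomorphic to `p`. -/
def Contains {n m : ℕ} (π : Equiv.Perm (Fin n)) (p : Equiv.Perm (Fin m)) : Prop :=
  ∃ f : Fin m → Fin n, StrictMono f ∧ ∀ a b : Fin m, π (f a) < π (f b) ↔ p a < p b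

/-- `π` avoids the pattern `p`. -/
def Avoids {n m : ℕ} (π : Equiv.Perm (Fin n)) (p : Equiv.Perm (Fin m)) : Prop :=
  ¬ Contains π p

/-- The number of inversions of `π`: pairs of positions `i < j` with `π i > π j`. -/
noncomputable def invCount {n : ℕ} (π : Equiv.Perm (Fin n)) : ℕ :=
  Nat.card {ij : Fin n × Fin n // ij.1 < ij.2 ∧ π ij.2 < π ij.1}

def p1324 : Equiv.Perm (Fin 4) := ⟨![0,2,1,3], ![0,2,1,3], by decide, by decide⟩
def p1243 : Equiv.Perm (Fin 4) := ⟨![0,1,3,2], ![0,1,3,2], by decide, by decide⟩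

theorem contains_p1324_of_lt {n : ℕ} {π : Equiv.Perm (Fin n)} {a b c d : Fin n}
    (hab : a < b) (hbc : b < c) (hcd : c < d)
    (hac' : π a < π c) (hcb' : π c < π b) (hbd' : π b < π d) : Contains π p1324 := by
  refine ⟨![a, b, c, d], ?_, ?_⟩
  · rw [Fin.strictMono_iff_lt_succ]
    intro i
    fin_cases i <;> simpa
  · intro x y
    fin_cases x <;> fin_cases y <;> simp [p1324] <;> order

theorem contains_p1243_of_lt {n : ℕ} {π : Equiv.Perm (Fin n)} {a b c d : Fin n}
    (hab : a < b) (hbc : b < c) (hcd : c < d)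
    (hab' : π a < π b) (hbd' : π b < π d) (hdc' : π d < π c) : Contains π p1243 := by
  refine ⟨![a, b, c, d], ?_, ?_⟩
  · rw [Fin.strictMono_iff_lt_succ]
    intro i
    fin_cases i <;> simpa
  · intro x y
    fin_cases x <;> fin_cases y <;> simp [p1243] <;> order

/-- `π` has no occurrence of the pattern 132. -/
def Avoids132 {n : ℕ} (π : Equiv.Perm (Fin n)) : Prop :=
  ∀ a b c, a < b → b < c → π a < π c → ¬ π c < π b

theorem Avoids132.avoids_p1324 {n : ℕ} {π : Equiv.Perm (Fin n)} (h : Avoids132 π) :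
    Avoids π p1324 := by
  rintro ⟨f, hf, hp⟩
  exact h (f 0) (f 1) (f 2) (hf (by decide)) (hf (by decide))
    ((hp 0 2).2 (by decide)) ((hp 2 1).2 (by decide))

theorem Avoids132.avoids_p1243 {n : ℕ} {π : Equiv.Perm (Fin n)} (h : Avoids132 π) :
    Avoids π p1243 := by
  rintro ⟨f, hf, hp⟩
  exact h (f 0) (f 2) (f 3) (hf (by decide)) (hf (by decide))
    ((hp 0 3).2 (by decide)) ((hp 3 2).2 (by decide))

theorem invCount_eq_card_filter {n : ℕ} (π : Equiv.Perm (Fin n)) :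
    invCount π =
      (Finset.univ.filter fun ij : Fin n × Fin n => ij.1 < ij.2 ∧ π ij.2 < π ij.1).card := by
  rw [invCount, Nat.card_eq_fintype_card, Fintype.card_subtype]

/-- In a permutation avoiding 1324 and 1243 that contains 132, every entry outside a given
occurrence of 132 forms an inversion with an entry of that occurrence. -/
theorem le_invCount_of_occurrence_132 {n : ℕ} {π : Equiv.Perm (Fin n)}
    (h₁ : Avoids π p1324) (h₂ : Avoids π p1243) {a b c : Fin n}
    (hab : a < b) (hbc : b < c) (hac' : π a < π c) (hcb' : π c < π b) :
    n ≤ invCount π + 2 := by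
  have key : ∀ x : Fin n, ∃ p : Fin n × Fin n, (x ≠ a → x ≠ c → p.1 < p.2 ∧ π p.2 < π p.1) ∧
      (x = b → p = (b, c)) ∧ (x ≠ a → x ≠ b → x ≠ c →
        (p.1 = x ∧ (p.2 = a ∨ p.2 = b ∨ p.2 = c)) ∨
        (p.2 = x ∧ (p.1 = a ∨ p.1 = b ∨ p.1 = c))) := by
    intro x
    by_cases hx : x = a ∨ x = b ∨ x = c
    · exact ⟨(b, c), by grind⟩
    · push Not at hx
      obtain ⟨hxa, hxb, hxc⟩ := hx
      have va : π x ≠ π a := π.injective.ne hxa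
      have vb : π x ≠ π b := π.injective.ne hxb
      have vc : π x ≠ π c := π.injective.ne hxc
      have e₁ : c < x → π x < π b := fun h => by
        by_contra hlt
        exact h₁ (contains_p1324_of_lt hab hbc h hac' hcb' (by order))
      have e₂ : x < a → π a < π x := fun h => by
        by_contra hlt
        exact h₂ (contains_p1243_of_lt h hab hbc (by order) hac' hcb')
      have e₃ : a < x → x < b → π a < π x → π c < π x := fun h h' h'' => by
        by_contra hlt
        exact h₂ (contains_p1243_of_lt h h' hbc h'' (by order) hcb')
      have : (x < a ∧ π a < π x) ∨ (a < x ∧ π x < π a) ∨ (b < x ∧ π x < π b) ∨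
          (x < c ∧ π c < π x) := by
        rcases lt_or_gt_of_ne hxa with h | h
        · exact .inl ⟨h, e₂ h⟩
        rcases lt_or_gt_of_ne va with h' | h'
        · exact .inr (.inl ⟨h, h'⟩)
        rcases lt_or_gt_of_ne hxb with k | k
        · exact .inr (.inr (.inr ⟨k.trans hbc, e₃ h k h'⟩))
        rcases lt_or_gt_of_ne hxc with l | l
        · rcases lt_or_gt_of_ne vb with m | m
          · exact .inr (.inr (.inl ⟨k, m⟩))
          · exact .inr (.inr (.inr ⟨l, by order⟩))
        · exact .inr (.inr (.inl ⟨k, e₁ l⟩))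
      rcases this with h | h | h | h
      · exact ⟨(x, a), by grind⟩
      · exact ⟨(a, x), by grind⟩
      · exact ⟨(b, x), by grind⟩
      · exact ⟨(x, c), by grind⟩
  choose g hg hgb hgx using key
  have hcard : ((Finset.univ.erase a).erase c).card ≤ invCount π := by
    rw [invCount_eq_card_filter]
    refine Finset.card_le_card_of_injOn g ?_ ?_
    · intro x hx
      simp only [Finset.coe_erase, Finset.coe_univ, Set.mem_sdiff, Set.mem_univ,
        Set.mem_singleton_iff, true_and] at hx
      simpa using hg x hx.1 hx.2
    · intro x hx y hy hxy
      simp only [Finset.coe_erase, Finset.coe_univ, Set.mem_sdiff, Set.mem_univ,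
        Set.mem_singleton_iff, true_and] at hx hy
      have hbx := hgb x
      have hby := hgb y
      have hxx := hgx x hx.1
      have hyy := hgx y hy.1
      clear hg hgb hgx
      by_cases x = b <;> by_cases y = b <;> grind
  rw [Finset.card_erase_of_mem (by simp; order), Finset.card_erase_of_mem (by simp),
    Finset.card_univ, Fintype.card_fin] at hcard
  omega

theorem avoids_iff_avoids132 {n : ℕ} {π : Equiv.Perm (Fin n)} (h : invCount π + 3 ≤ n) :
    Avoids π p1324 ∧ Avoids π p1243 ↔ Avoids132 π := by
  refine ⟨fun ⟨h₁, h₂⟩ a b c hab hbc hac' hcb' => ?_, fun h => ⟨h.avoids_p1324, h.avoids_p1243⟩⟩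
  have := le_invCount_of_occurrence_132 h₁ h₂ hab hbc hac' hcb'
  omega

/-- The Lehmer code of `π`: the number of inversions whose left end is at position `i`. -/
def lehmerCode {n : ℕ} (π : Equiv.Perm (Fin n)) (i : Fin n) : ℕ :=
  (Finset.univ.filter fun j => i < j ∧ π j < π i).card

theorem sum_lehmerCode {n : ℕ} (π : Equiv.Perm (Fin n)) :
    ∑ i, lehmerCode π i = invCount π := by
  simp only [invCount_eq_card_filter, lehmerCode, Finset.card_filter, Fintype.sum_prod_type]

theorem lehmerCode_lt {n : ℕ} (π : Equiv.Perm (Fin n)) (i : Fin n) :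
    lehmerCode π i < n - i := by
  have : lehmerCode π i ≤ (Finset.Ioi i).card :=
    Finset.card_le_card fun j hj => by simp_all
  rw [Fin.card_Ioi] at this
  omega

theorem not_lt_of_lehmerCode_eq {n : ℕ} {π σ : Equiv.Perm (Fin n)} {i : Fin n}
    (hcode : lehmerCode π i = lehmerCode σ i) (hlt : ∀ j < i, π j = σ j) : ¬ π i < σ i := by
  intro h
  have image_card (τ : Equiv.Perm (Fin n)) : lehmerCode τ i =
      (Finset.univ.filter fun v => i < τ.symm v ∧ v < τ i).card := by
    refine Finset.card_bij (fun j _ => τ j) (by simp) (fun _ _ _ _ h => τ.injective h) ?_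
    intro v hv
    exact ⟨τ.symm v, by simpa using hv, by simp⟩
  have hsymm : ∀ v, π.symm v < i ↔ σ.symm v < i := by
    intro v
    constructor
    · intro hv
      have := hlt _ hv
      rw [Equiv.apply_symm_apply] at this
      rwa [this, Equiv.symm_apply_apply]
    · intro hv
      have := hlt _ hv
      rw [Equiv.apply_symm_apply] at this
      rwa [← this, Equiv.symm_apply_apply]
  have hne (τ : Equiv.Perm (Fin n)) (v : Fin n) (hv : v ≠ τ i) : i ≠ τ.symm v := by
    rintro rfl
    simp at hv
  rw [image_card, image_card] at hcode
  refine hcode.not_lt (Finset.card_lt_card (Finset.ssubset_iff_of_subset ?_ |>.2 ⟨π i, ?_⟩))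
  · intro v
    simp only [Finset.mem_filter, Finset.mem_univ, true_and]
    rintro ⟨h₁, h₂⟩
    have := hne σ v (by order)
    have := hsymm v
    exact ⟨by grind, by order⟩
  · have := hne σ (π i) (by order)
    have := hsymm (π i)
    rw [Equiv.symm_apply_apply] at this
    simp only [Finset.mem_filter, Finset.mem_univ, true_and]
    exact ⟨⟨by grind, h⟩, by simp⟩

theorem lehmerCode_injective {n : ℕ} :
    Function.Injective (lehmerCode : Equiv.Perm (Fin n) → Fin n → ℕ) := by
  intro π σ h
  ext i
  congr 1
  induction i using WellFoundedLT.induction with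
  | ind i ih =>
    have h₁ := not_lt_of_lehmerCode_eq (congrFun h i) ih
    have h₂ := not_lt_of_lehmerCode_eq (congrFun h i).symm fun j hj => (ih j hj).symm
    order

theorem exists_lehmerCode_eq {n : ℕ} {g : Fin n → ℕ} (hg : ∀ i, g i < n - i) :
    ∃ π : Equiv.Perm (Fin n), lehmerCode π = g := by
  let F : Equiv.Perm (Fin n) → (i : Fin n) → Fin (n - i) :=
    fun π i => ⟨lehmerCode π i, lehmerCode_lt π i⟩
  have hF : Function.Bijective F := by
    refine (Fintype.bijective_iff_injective_and_card F).2 ⟨fun π σ h => ?_, ?_⟩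
    · exact lehmerCode_injective (funext fun i => congrArg Fin.val (congrFun h i))
    · rw [Fintype.card_perm, Fintype.card_pi, Fintype.card_fin]
      simp only [Fintype.card_fin]
      rw [Fin.prod_univ_eq_prod_range (fun i => n - i) n, ← Nat.descFactorial_eq_prod_range,
        Nat.descFactorial_self]
  obtain ⟨π, hπ⟩ := hF.surjective fun i => ⟨g i, hg i⟩
  exact ⟨π, funext fun i => congrArg Fin.val (congrFun hπ i)⟩

theorem Avoids132.antitone_lehmerCode {n : ℕ} {π : Equiv.Perm (Fin n)} (h : Avoids132 π) :
    Antitone (lehmerCode π) := by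
  intro i j hij
  rcases hij.eq_or_lt with rfl | hij
  · rfl
  refine Finset.card_le_card fun l => ?_
  simp only [Finset.mem_filter, Finset.mem_univ, true_and]
  rintro ⟨h₁, h₂⟩
  have hne : π l ≠ π i := π.injective.ne (by order)
  have := h i j l hij h₁
  exact ⟨by order, by grind⟩

theorem exists_lehmerCode_lt_of_occurrence_132 {n : ℕ} {π : Equiv.Perm (Fin n)} (m : ℕ) :
    ∀ a b c : Fin n, (b : ℕ) - a = m → a < b → b < c → π a < π c → π c < π b →
      ∃ i j, i < j ∧ lehmerCode π i < lehmerCode π j := by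
  induction m using Nat.strong_induction_on with
  | _ m ih =>
    intro a b c hm hab hbc hac' hcb'
    by_cases hx : ∃ x, a < x ∧ x < b
    · obtain ⟨x, hax, hxb⟩ := hx
      have hne : π x ≠ π c := π.injective.ne (by order)
      rcases lt_or_gt_of_ne hne with h | h
      · exact ih (b - x) (by omega) x b c rfl hxb hbc h hcb'
      · exact ih (x - a) (by omega) a x c rfl hax (by order) hac' h
    · push Not at hx
      refine ⟨a, b, hab,
        Finset.card_lt_card (Finset.ssubset_iff_of_subset ?_ |>.2 ⟨c, ?_⟩)⟩
      · intro l
        simp only [Finset.mem_filter, Finset.mem_univ, true_and]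
        rintro ⟨h₁, h₂⟩
        have hlb : l ≠ b := by
          rintro rfl
          order
        have := hx l h₁
        exact ⟨by order, by order⟩
      · simp only [Finset.mem_filter, Finset.mem_univ, true_and]
        exact ⟨⟨hbc, hcb'⟩, fun h => by order⟩

theorem avoids132_iff_antitone_lehmerCode {n : ℕ} {π : Equiv.Perm (Fin n)} :
    Avoids132 π ↔ Antitone (lehmerCode π) := by
  refine ⟨Avoids132.antitone_lehmerCode, fun h a b c hab hbc hac' hcb' => ?_⟩
  obtain ⟨i, j, hij, hlt⟩ :=
    exists_lehmerCode_lt_of_occurrence_132 _ a b c rfl hab hbc hac' hcb'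
  exact (h hij.le).not_gt hlt

theorem Antitone.apply_lt_sub_of_sum_lt {n : ℕ} {g : Fin n → ℕ} (hg : Antitone g)
    (hsum : ∑ i, g i < n) (i : Fin n) : g i < n - i := by
  have h₁ : (Finset.Iic i).card • g i ≤ ∑ j ∈ Finset.Iic i, g j :=
    Finset.card_nsmul_le_sum _ _ _ fun j hj => hg (Finset.mem_Iic.1 hj)
  have h₂ : ∑ j ∈ Finset.Iic i, g j ≤ ∑ j, g j :=
    Finset.sum_le_sum_of_subset (Finset.subset_univ _)
  rw [Fin.card_Iic, smul_eq_mul] at h₁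
  have := i.isLt
  rcases Nat.eq_zero_or_pos (g i) with h | h
  · omega
  · have : (i : ℕ) + g i ≤ (i + 1) * g i := by nlinarith
    omega

theorem Multiset.eq_of_filter_ne_zero_eq {s t : Multiset ℕ} (hcard : s.card = t.card)
    (h : s.filter (· ≠ 0) = t.filter (· ≠ 0)) : s = t := by
  have hs := Multiset.filter_add_not (· ≠ 0) s
  have ht := Multiset.filter_add_not (· ≠ 0) t
  have zeros (u : Multiset ℕ) : u.filter (fun x => ¬ x ≠ 0) =
      Multiset.replicate (u.filter (fun x => ¬ x ≠ 0)).card 0 :=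
    Multiset.eq_replicate_card.2 (by simp)
  have hc : (s.filter (fun x => ¬ x ≠ 0)).card = (t.filter (fun x => ¬ x ≠ 0)).card := by
    have hs' := congrArg Multiset.card hs
    have ht' := congrArg Multiset.card ht
    rw [Multiset.card_add] at hs' ht'
    rw [h] at hs'
    omega
  rw [← hs, ← ht, h, zeros s, zeros t, hc]

/-- The partition of `k` whose parts are the nonzero values of a function with sum `k`. -/
def partitionOfSum {n k : ℕ} (f : {f : Fin n → ℕ // Antitone f ∧ ∑ i, f i = k}) :
    Nat.Partition k :=
  Nat.Partition.ofSums k (Finset.univ.val.map f.1) f.2.2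

theorem partitionOfSum_injective {n k : ℕ} :
    Function.Injective (partitionOfSum (n := n) (k := k)) := by
  rintro ⟨f, hf, hfk⟩ ⟨g, hg, hgk⟩ h
  have h' : (Finset.univ.val.map f) = Finset.univ.val.map g :=
    Multiset.eq_of_filter_ne_zero_eq (by simp) (congrArg Nat.Partition.parts h)
  rw [Fin.univ_val_map, Fin.univ_val_map, Multiset.coe_eq_coe] at h'
  exact Subtype.ext (List.ofFn_injective (h'.eq_of_sortedGE hf.sortedGE_ofFn hg.sortedGE_ofFn))

theorem partitionOfSum_surjective {n k : ℕ} (hkn : k ≤ n) :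
    Function.Surjective (partitionOfSum (n := n) (k := k)) := by
  intro p
  have hcard : p.parts.card ≤ k := by
    have := Multiset.card_nsmul_le_sum (s := p.parts) (a := 1) fun x hx => p.parts_pos hx
    rwa [p.parts_sum, smul_eq_mul, mul_one] at this
  set s := p.parts + Multiset.replicate (n - p.parts.card) 0 with hs
  have hlen : (s.sort (· ≥ ·)).length = n := by
    rw [Multiset.length_sort, hs, Multiset.card_add, Multiset.card_replicate]
    omega
  let f : Fin n → ℕ := fun i => (s.sort (· ≥ ·)).get (i.cast hlen.symm)
  have hmap : Finset.univ.val.map f = s := by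
    rw [Fin.univ_val_map, ← Multiset.sort_eq s (· ≥ ·)]
    congr 1
    refine List.ext_get (by simp [hs]; omega) fun i h₁ h₂ => ?_
    simp [f]
  have hanti : Antitone f := fun i j hij =>
    (Multiset.pairwise_sort s (· ≥ ·)).sortedGE.antitone_get (by simpa using hij)
  have hsum : ∑ i, f i = k := by
    rw [Finset.sum, hmap, hs]
    simp [p.parts_sum]
  refine ⟨⟨f, hanti, hsum⟩, Nat.Partition.ext ?_⟩
  change (Finset.univ.val.map f).filter (· ≠ 0) = p.parts
  rw [hmap, hs, Multiset.filter_add, Multiset.filter_eq_self.2 fun x hx => (p.parts_pos hx).ne',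
    Multiset.filter_eq_nil.2 fun x hx => by simp [Multiset.eq_of_mem_replicate hx], add_zero]

/-- For every `k ≥ 0` and every `n ≥ k + 3`, the number of permutations of length `n`
with exactly `k` inversions avoiding both 1324 and 1243 equals `p(k)`, the number of
integer partitions of `k`. -/
theorem av_1324_1243_eq (k n : ℕ) (hn : k + 3 ≤ n) :
    Nat.card {π : Equiv.Perm (Fin n) // invCount π = k ∧
      Avoids π p1324 ∧ Avoids π p1243} = Nat.card (Nat.Partition k) := by
  have hiff (π : Equiv.Perm (Fin n)) :
      (invCount π = k ∧ Avoids π p1324 ∧ Avoids π p1243) ↔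
        Antitone (lehmerCode π) ∧ ∑ i, lehmerCode π i = k := by
    rw [sum_lehmerCode, and_comm]
    refine and_congr_left fun hk => ?_
    rw [avoids_iff_avoids132 (by omega), avoids132_iff_antitone_lehmerCode]
  let code (π : {π : Equiv.Perm (Fin n) // invCount π = k ∧
      Avoids π p1324 ∧ Avoids π p1243}) : {f : Fin n → ℕ // Antitone f ∧ ∑ i, f i = k} :=
    ⟨lehmerCode π.1, (hiff π.1).1 π.2⟩
  have hcode : Function.Bijective code := by
    refine ⟨fun π σ h => Subtype.ext (lehmerCode_injective (congrArg Subtype.val h)), ?_⟩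
    rintro ⟨f, hf, hfk⟩
    obtain ⟨π, rfl⟩ := exists_lehmerCode_eq (hf.apply_lt_sub_of_sum_lt (by omega))
    exact ⟨⟨π, (hiff π).2 ⟨hf, hfk⟩⟩, rfl⟩
  exact Nat.card_eq_of_bijective _ (Function.Bijective.comp
    ⟨partitionOfSum_injective, partitionOfSum_surjective (by omega)⟩ hcode)
end

section
/- For every k ≥ 0 and every n ≥ k + 2, the number of permutations of length n with exactly k inversions that avoid both 1324 and 1432 equals the number of pairs (λ, μ) of integer partitions with |λ| + |μ| = k such that all parts of μ are equal (μ may be empty). -/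
def p1432 : Equiv.Perm (Fin 4) := ⟨![0,3,2,1], ![0,3,2,1], by decide, by decide⟩

open Finset

section Patterns

variable {n : ℕ} {π : Equiv.Perm (Fin n)}

lemma contains_p1324_iff : Contains π p1324 ↔ ∃ p q r s, p < q ∧ q < r ∧ r < s ∧
    π p < π r ∧ π r < π q ∧ π q < π s := by
  constructor
  · rintro ⟨f, hf, h⟩
    exact ⟨f 0, f 1, f 2, f 3, hf (by decide), hf (by decide), hf (by decide),
      (h 0 2).2 (by decide), (h 2 1).2 (by decide), (h 1 3).2 (by decide)⟩
  · rintro ⟨p, q, r, s, hpq, hqr, hrs, h1, h2, h3⟩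
    refine ⟨![p, q, r, s], ?_, ?_⟩
    · refine Fin.strictMono_iff_lt_succ.2 fun i => ?_
      fin_cases i <;> simpa
    · intro a b
      fin_cases a <;> fin_cases b <;> simp [p1324] <;> order

lemma contains_p1432_iff : Contains π p1432 ↔ ∃ p q r s, p < q ∧ q < r ∧ r < s ∧
    π p < π s ∧ π s < π r ∧ π r < π q := by
  constructor
  · rintro ⟨f, hf, h⟩
    exact ⟨f 0, f 1, f 2, f 3, hf (by decide), hf (by decide), hf (by decide),
      (h 0 3).2 (by decide), (h 3 2).2 (by decide), (h 2 1).2 (by decide)⟩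
  · rintro ⟨p, q, r, s, hpq, hqr, hrs, h1, h2, h3⟩
    refine ⟨![p, q, r, s], ?_, ?_⟩
    · refine Fin.strictMono_iff_lt_succ.2 fun i => ?_
      fin_cases i <;> simpa
    · intro a b
      fin_cases a <;> fin_cases b <;> simp [p1432] <;> order

end Patterns

/-- The Lehmer code: the number of later positions carrying a smaller value. -/
def lehmer {n : ℕ} (π : Equiv.Perm (Fin n)) (i : Fin n) : ℕ :=
  #{j | i < j ∧ π j < π i}

section Lehmer

variable {n : ℕ} {π : Equiv.Perm (Fin n)}

lemma invCount_eq_sum_lehmer (π : Equiv.Perm (Fin n)) : invCount π = ∑ i, lehmer π i := by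
  simp only [invCount, lehmer, Nat.card_eq_fintype_card, Fintype.card_subtype, card_filter,
    Fintype.sum_prod_type]

lemma add_lehmer_lt (π : Equiv.Perm (Fin n)) (i : Fin n) : i + lehmer π i < n := by
  have h : lehmer π i ≤ #(Ioi i) := card_le_card fun j hj => by simp_all
  rw [Fin.card_Ioi] at h
  omega

lemma lehmer_eq_card_values (π : Equiv.Perm (Fin n)) (i : Fin n) :
    lehmer π i = #{v | v < π i ∧ ∀ j < i, π j ≠ v} := by
  refine card_equiv π fun j => ?_
  simp only [mem_filter, mem_univ, true_and, ne_eq, EmbeddingLike.apply_eq_iff_eq]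
  constructor
  · rintro ⟨h1, h2⟩
    exact ⟨h2, fun k hk hkj => by order⟩
  · rintro ⟨h1, h2⟩
    refine ⟨lt_of_le_of_ne (not_lt.1 fun h => h2 j h rfl) ?_, h1⟩
    rintro rfl
    exact lt_irrefl _ h1

lemma apply_le_add_lehmer (π : Equiv.Perm (Fin n)) (i : Fin n) :
    (π i : ℕ) ≤ i + lehmer π i := by
  have h : Iio (π i) ⊆ (Iio i).image π ∪
      ({v | v < π i ∧ ∀ j < i, π j ≠ v} : Finset (Fin n)) := by
    intro v hv
    by_cases h : ∃ j < i, π j = v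
    · simp [h]
    · push Not at h
      simp_all
  have h' := (card_le_card h).trans (card_union_le _ _)
  rw [← lehmer_eq_card_values, card_image_of_injective _ π.injective] at h'
  simpa using h'

lemma lehmer_injective : Function.Injective (lehmer (n := n)) := by
  have key : ∀ (π σ : Equiv.Perm (Fin n)) (i : Fin n), (∀ j < i, π j = σ j) → π i < σ i →
      lehmer π i < lehmer σ i := by
    intro π σ i hj hlt
    rw [lehmer_eq_card_values, lehmer_eq_card_values]
    refine card_lt_card (ssubset_iff.2 ⟨π i, by simp, ?_⟩)
    intro v hv
    rcases mem_insert.1 hv with rfl | hv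
    · simp only [mem_filter, mem_univ, true_and]
      exact ⟨hlt, fun j hji h => by
        rw [← hj j hji] at h
        exact hji.ne (π.injective h)⟩
    · simp only [mem_filter, mem_univ, true_and] at hv ⊢
      exact ⟨hv.1.trans hlt, fun j hji => hj j hji ▸ hv.2 j hji⟩
  intro π σ h
  ext1 i
  induction i using WellFoundedLT.induction with
  | ind i ih =>
    rcases lt_trichotomy (π i) (σ i) with h' | h' | h'
    · exact absurd (congrFun h i) (key π σ i ih h').ne
    · exact h'
    · exact absurd (congrFun h i) (key σ π i (fun j hj => (ih j hj).symm) h').ne.symm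

/-- Every sequence `c` with `i + c i < n` is a Lehmer code. -/
lemma exists_lehmer_eq (c : Fin n → ℕ) (hc : ∀ i, i + c i < n) :
    ∃ π : Equiv.Perm (Fin n), lehmer π = c := by
  let F : Equiv.Perm (Fin n) → ∀ i : Fin n, Fin (n - i) := fun π i =>
    ⟨lehmer π i, by have := add_lehmer_lt π i; omega⟩
  have hF : Function.Bijective F := by
    rw [Fintype.bijective_iff_injective_and_card]
    constructor
    · intro π σ h
      refine lehmer_injective (funext fun i => ?_)
      exact congrArg Fin.val (congrFun h i)
    · rw [Fintype.card_perm, Fintype.card_pi]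
      simp only [Fintype.card_fin]
      rw [Fin.prod_univ_eq_prod_range (fun i => n - i) n, ← Nat.descFactorial_eq_prod_range,
        Nat.descFactorial_self]
  obtain ⟨π, hπ⟩ := hF.2 fun i => ⟨c i, by have := hc i; omega⟩
  exact ⟨π, funext fun i => congrArg Fin.val (congrFun hπ i)⟩

lemma lehmer_lt_of_inversion {i j : Fin n} (hij : i < j) (h : π j < π i) :
    lehmer π j < lehmer π i := by
  refine card_lt_card (ssubset_iff.2 ⟨j, by simp, ?_⟩)
  intro x hx
  rcases mem_insert.1 hx with rfl | hx
  · simp [hij, h]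
  · simp only [mem_filter, mem_univ, true_and] at hx ⊢
    exact ⟨hij.trans hx.1, hx.2.trans h⟩

lemma lt_of_lehmer_le {i j : Fin n} (hij : i < j) (h : lehmer π i ≤ lehmer π j) :
    π i < π j :=
  lt_of_le_of_ne (not_lt.1 fun h' => (lehmer_lt_of_inversion hij h').not_ge h)
    (π.injective.ne hij.ne)

/-- An ascent of the Lehmer code produces an occurrence of `132`. -/
lemma exists_of_lehmer_lt {i j : Fin n} (hij : i < j) (h : lehmer π i < lehmer π j) :
    ∃ k, j < k ∧ π i < π k ∧ π k < π j := by
  by_contra! hk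
  refine h.not_ge (card_le_card fun x hx => ?_)
  simp only [mem_filter, mem_univ, true_and] at hx ⊢
  refine ⟨hij.trans hx.1, ?_⟩
  have h1 : π x ≠ π i := π.injective.ne (hij.trans hx.1).ne'
  have h2 := hk x hx.1
  by_contra h3
  exact (h2 (lt_of_le_of_ne (not_lt.1 h3) h1.symm)).not_gt hx.2

/-- An occurrence of `132` produces an ascent of the Lehmer code. -/
lemma exists_lehmer_lt_of_132 {i j k : Fin n} (hij : i < j) (hjk : j < k) (hik : π i < π k)
    (hkj : π k < π j) : ∃ x y, x < y ∧ y ≤ j ∧ lehmer π x < lehmer π y := by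
  obtain ⟨x, hx, hmax⟩ := exists_max_image ({x | x < j ∧ π x < π k} : Finset (Fin n)) id
    ⟨i, by simp [hij, hik]⟩
  simp only [mem_filter, mem_univ, true_and, id_eq] at hx hmax
  have hxj : (x : ℕ) < j := hx.1
  let y : Fin n := ⟨x + 1, by omega⟩
  have hxy : x < y := Nat.lt_succ_self _
  have hyj : y ≤ j := hxj
  have hky : π k < π y := by
    rcases hyj.eq_or_lt with h | h
    · rwa [h]
    · refine lt_of_le_of_ne (not_lt.1 fun h' => ?_) (π.injective.ne (by order))
      exact (hmax y ⟨h, h'⟩).not_gt hxy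
  refine ⟨x, y, hxy, hyj, card_lt_card (ssubset_iff.2 ⟨k, by simp [hx.2.le], ?_⟩)⟩
  intro z hz
  rcases mem_insert.1 hz with rfl | hz
  · simp only [mem_filter, mem_univ, true_and]
    exact ⟨by order, hky⟩
  · simp only [mem_filter, mem_univ, true_and] at hz ⊢
    refine ⟨lt_of_le_of_ne (Nat.succ_le_of_lt hz.1) ?_, by order⟩
    rintro rfl
    order

end Lehmer

section Structure

variable {n : ℕ} {π : Equiv.Perm (Fin n)}

/-- A permutation with few inversions maps some proper initial segment to itself. -/
lemma exists_cut (h : invCount π + 2 ≤ n) :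
    ∃ m, 0 < m ∧ m < n ∧ ∀ i : Fin n, (i : ℕ) < m ↔ (π i : ℕ) < m := by
  obtain ⟨m, hm0, hmn, hm⟩ : ∃ m, 0 < m ∧ m < n ∧ ∀ i : Fin n, (i : ℕ) < m →
      i + lehmer π i < m := by
    by_contra! hc
    have hsub : Icc 1 (n - 1) ⊆ univ.biUnion fun i : Fin n => Ioc (i : ℕ) (i + lehmer π i) := by
      intro m hm
      rw [mem_Icc] at hm
      obtain ⟨i, hi⟩ := hc m (by omega) (by omega)
      simp only [mem_biUnion, mem_univ, true_and, mem_Ioc]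
      exact ⟨i, hi⟩
    have := (card_le_card hsub).trans card_biUnion_le
    simp only [Nat.card_Icc, Nat.card_Ioc, add_tsub_cancel_left] at this
    rw [← invCount_eq_sum_lehmer] at this
    omega
  refine ⟨m, hm0, hmn, ?_⟩
  let S : Finset (Fin n) := {x | (x : ℕ) < m}
  have hS : S.map π.toEmbedding = S := by
    refine eq_of_subset_of_card_le ?_ (by simp)
    intro x hx
    obtain ⟨i, hi, rfl⟩ := mem_map.1 hx
    have hi' : (i : ℕ) < m := by simpa [S] using hi
    have := apply_le_add_lehmer π i
    have := hm i hi'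
    simp only [Equiv.coe_toEmbedding, mem_filter, mem_univ, true_and, S]
    omega
  intro i
  have h1 : i ∈ S ↔ π i ∈ S.map π.toEmbedding := by simp
  rw [hS] at h1
  simpa [S] using h1

/-- The shape of a Lehmer code of length `n`: weakly decreasing up to `n - a - b`, then `b` entries
equal to `a`, then `a` zeros. -/
def IsShape {n : ℕ} (c : Fin n → ℕ) (a b : ℕ) : Prop :=
  a + b ≤ n ∧ (∀ i j : Fin n, i < j → j + a + b < n → c j ≤ c i) ∧
    (∀ i : Fin n, n ≤ i + a + b → i + a < n → c i = a) ∧ ∀ i : Fin n, n ≤ i + a → c i = 0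

lemma apply_lt_of_isShape {a b : ℕ} (h : IsShape (lehmer π) a b) {q s : Fin n}
    (hq : n ≤ q + a + b) (hqa : q + a < n) (hs : n ≤ s + a) : π s < π q := by
  obtain ⟨hab, -, h2, -⟩ := h
  have hsub : ({j | q < j ∧ π j < π q} : Finset (Fin n)) ⊆ Ici ⟨n - a, by omega⟩ := by
    intro j hj
    simp only [mem_filter, mem_univ, true_and] at hj
    have h3 := lehmer_lt_of_inversion hj.1 hj.2
    have hqj : (q : ℕ) < j := hj.1
    rw [h2 q hq hqa] at h3
    rw [mem_Ici, Fin.le_def]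
    by_contra h4
    simp only [not_le] at h4
    rw [h2 j (by omega) (by omega)] at h3
    exact lt_irrefl _ h3
  have hcard : #({j | q < j ∧ π j < π q} : Finset (Fin n)) = a := h2 q hq hqa
  have heq := eq_of_subset_of_card_le hsub (by rw [hcard, Fin.card_Ici]; simp only; omega)
  have hsm : s ∈ Ici (⟨n - a, by omega⟩ : Fin n) := by
    rw [mem_Ici, Fin.le_def]
    simp only
    omega
  rw [← heq] at hsm
  simp only [mem_filter] at hsm
  exact hsm.2.2

lemma avoids_of_isShape {a b : ℕ} (h : IsShape (lehmer π) a b) :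
    Avoids π p1324 ∧ Avoids π p1432 := by
  have hq : ∀ p q r : Fin n, p < q → q < r → π p < π r → π r < π q →
      n ≤ q + a + b ∧ q + a < n ∧ n ≤ r + a := by
    intro p q r hpq hqr h1 h2
    have hle : n ≤ q + a + b := by
      by_contra! hlt
      obtain ⟨x, y, hxy, hyq, hl⟩ := exists_lehmer_lt_of_132 hpq hqr h1 h2
      have : (y : ℕ) ≤ q := hyq
      exact hl.not_ge (h.2.1 x y hxy (by omega))
    have hl := lehmer_lt_of_inversion hqr h2
    have hqa : q + a < n := by
      by_contra! hge
      rw [h.2.2.2 q hge] at hl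
      omega
    refine ⟨hle, hqa, ?_⟩
    by_contra! hlt
    have : (q : ℕ) < r := hqr
    rw [h.2.2.1 q hle hqa, h.2.2.1 r (by omega) hlt] at hl
    exact lt_irrefl _ hl
  constructor
  · rw [Avoids, contains_p1324_iff]
    rintro ⟨p, q, r, s, hpq, hqr, hrs, h1, h2, h3⟩
    obtain ⟨ha, hb, hc⟩ := hq p q r hpq hqr h1 h2
    have : (r : ℕ) < s := hrs
    exact h3.not_gt (apply_lt_of_isShape h ha hb (by omega))
  · rw [Avoids, contains_p1432_iff]
    rintro ⟨p, q, r, s, hpq, hqr, hrs, h1, h2, h3⟩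
    obtain ⟨ha, hb, hc⟩ := hq p q r hpq hqr (h1.trans h2) h3
    have : (r : ℕ) < s := hrs
    have hl := lehmer_lt_of_inversion hrs h2
    rw [h.2.2.2 r hc] at hl
    omega

lemma exists_isShape (hn : invCount π + 2 ≤ n) (h1 : Avoids π p1324) (h2 : Avoids π p1432) :
    ∃ a b, (a = 0 ↔ b = 0) ∧ IsShape (lehmer π) a b := by
  obtain ⟨m, hm0, hmn, hm⟩ := exists_cut hn
  rw [Avoids, contains_p1324_iff] at h1
  rw [Avoids, contains_p1432_iff] at h2
  have hanti : ∀ i j : Fin n, i < j → (j : ℕ) < m → lehmer π j ≤ lehmer π i := by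
    intro i j hij hj
    by_contra! hlt
    obtain ⟨k, hjk, hik, hkj⟩ := exists_of_lehmer_lt hij hlt
    have hpj := (hm j).1 hj
    have hkm : (k : ℕ) < m := (hm k).2 (lt_trans hkj hpj)
    let s : Fin n := ⟨n - 1, by omega⟩
    have hs : ¬ (π s : ℕ) < m := by
      rw [← hm s]
      simp only [s]
      omega
    refine h1 ⟨i, j, k, s, hij, hjk, ?_, hik, hkj, ?_⟩
    · rw [Fin.lt_def]
      simp only [s]
      omega
    · rw [Fin.lt_def]
      omega
  have h0 : ∀ x : Fin n, m ≤ x → (⟨0, by omega⟩ : Fin n) < x ∧ π ⟨0, by omega⟩ < π x := by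
    intro x hx
    have hx' := mt (hm x).2 (by omega)
    have hz := (hm ⟨0, by omega⟩).1 hm0
    simp only [Fin.lt_def]
    omega
  have h213 : ∀ q r s : Fin n, m ≤ q → q < r → r < s → π r < π q → π s < π q := by
    intro q r s hq hqr hrs h
    have hqr' : (q : ℕ) < r := hqr
    refine lt_of_le_of_ne (not_lt.1 fun h' => h1 ⟨_, q, r, s, (h0 q hq).1, hqr, hrs,
      (h0 r (by omega)).2, h, h'⟩) (π.injective.ne (by order))
  have h321 : ∀ q r s : Fin n, m ≤ q → q < r → r < s → π r < π q → π r < π s := by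
    intro q r s hq hqr hrs h
    have hqr' : (q : ℕ) < r := hqr
    have hrs' : (r : ℕ) < s := hrs
    refine lt_of_le_of_ne (not_lt.1 fun h' => h2 ⟨_, q, r, s, (h0 q hq).1, hqr, hrs,
      (h0 s (by omega)).2, h', h⟩) (π.injective.ne (by order))
  have hext : ∀ d : ℕ, (∀ i : Fin n, m ≤ i → (i : ℕ) < d → lehmer π i = 0) →
      ∀ i j : Fin n, i < j → (j : ℕ) < d → lehmer π j ≤ lehmer π i := by
    intro d hd i j hij hj
    rcases lt_or_ge (j : ℕ) m with hjm | hjm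
    · exact hanti i j hij hjm
    · rw [hd j hjm hj]
      exact Nat.zero_le _
  by_cases hz : ∀ i : Fin n, m ≤ i → lehmer π i = 0
  · refine ⟨0, 0, Iff.rfl, by omega, ?_, ?_, ?_⟩
    · exact fun i j hij _ => hext n (fun i hi _ => hz i hi) i j hij j.2
    · intro i hi
      omega
    · intro i hi
      omega
  push Not at hz
  obtain ⟨q, hq, hmin⟩ := exists_min_image
    ({i | m ≤ (i : ℕ) ∧ lehmer π i ≠ 0} : Finset (Fin n)) id (by
      obtain ⟨i, hi⟩ := hz
      exact ⟨i, by simpa using hi⟩)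
  simp only [mem_filter, mem_univ, true_and, id_eq] at hq hmin
  obtain ⟨hmq, hq0⟩ := hq
  have hqn := add_lehmer_lt π q
  set a := lehmer π q with ha
  -- the positions after `q` with a value below `π q` are exactly the last `a` positions
  have hlast : ∀ r : Fin n, q < r → (π r < π q ↔ n ≤ r + a) := by
    set T : Finset (Fin n) := {j | q < j ∧ π j < π q} with hT
    have hTa : #T = a := rfl
    intro r hqr
    constructor
    · intro hr
      have hsub : Ici r ⊆ T := by
        intro s hs
        rw [mem_Ici] at hs
        simp only [hT, mem_filter, mem_univ, true_and]
        rcases hs.eq_or_lt with rfl | hs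
        · exact ⟨hqr, hr⟩
        · exact ⟨hqr.trans hs, h213 q r s hmq hqr hs hr⟩
      have := card_le_card hsub
      rw [hTa, Fin.card_Ici] at this
      omega
    · intro hr
      by_contra hr'
      have hsub : T ⊆ Ioi r := by
        intro s hs
        simp only [hT, mem_filter, mem_univ, true_and] at hs
        rw [mem_Ioi]
        by_contra hsr
        rcases (not_lt.1 hsr).eq_or_lt with rfl | hsr
        · exact hr' hs.2
        · exact hr' (h213 q s r hmq hs.1 hsr hs.2)
      have := card_le_card hsub
      rw [hTa, Fin.card_Ioi] at this
      omega
  refine ⟨a, n - a - q, by omega, by omega, ?_, ?_, ?_⟩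
  · intro i j hij hj
    refine hext q (fun i hi hiq => ?_) i j hij (by omega)
    by_contra hne
    have : (q : ℕ) ≤ i := hmin i ⟨hi, hne⟩
    omega
  · intro i hi hia
    have hqi : q ≤ i := by
      rw [Fin.le_def]
      omega
    rcases hqi.eq_or_lt with h | hqi
    · rw [← h]
    rw [ha]
    have hqi' : (q : ℕ) < i := hqi
    have hlt : π q < π i := lt_of_le_of_ne
      (not_lt.1 fun h => absurd ((hlast i hqi).1 h) (by omega)) (π.injective.ne hqi.ne)
    refine congrArg card (Finset.ext fun j => ?_)
    simp only [mem_filter, mem_univ, true_and]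
    constructor
    · rintro ⟨hij, hji⟩
      refine ⟨hqi.trans hij, ?_⟩
      have hij' : (i : ℕ) < j := hij
      let e : Fin n := ⟨n - 1, by omega⟩
      have hqe : q < e := by
        rw [Fin.lt_def]
        simp only [e]
        omega
      have he : π e < π q := (hlast e hqe).2 (by simp only [e]; omega)
      have hje : j ≤ e := by
        rw [Fin.le_def]
        simp only [e]
        omega
      rcases hje.eq_or_lt with h | hje
      · rwa [h]
      · exact (h321 i j e (by omega) hij hje hji).trans he
    · rintro ⟨hqj, hjq⟩
      have := (hlast j hqj).1 hjq
      refine ⟨?_, by order⟩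
      rw [Fin.lt_def]
      omega
  · intro i hi
    have hqi : q < i := by
      rw [Fin.lt_def]
      omega
    have hiq := (hlast i hqi).2 hi
    refine card_eq_zero.2 (filter_eq_empty_iff.2 ?_)
    rintro j - ⟨hij, hji⟩
    exact (h321 q i j hmq hqi hij hiq).not_gt hji

end Structure

/-- Data encoding an avoider with `k` inversions: a partition listed in weakly decreasing order, and
a partition of the form `a + ⋯ + a` with `b` parts. -/
structure IsCodeData (k : ℕ) (L : List ℕ) (a b : ℕ) : Prop where
  sorted : L.Pairwise (· ≥ ·)
  pos : ∀ x ∈ L, 0 < x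
  zero_iff : a = 0 ↔ b = 0
  sum_eq : L.sum + a * b = k

/-- The Lehmer code of length `n` attached to a list `L` and to `b` parts equal to `a`. -/
def dataCode (n : ℕ) (L : List ℕ) (a b j : ℕ) : ℕ :=
  L.getD j 0 + if n ≤ j + a + b ∧ j + a < n then a else 0

section Data

lemma List.getD_add_le_sum {L : List ℕ} (hL : ∀ x ∈ L, 0 < x) {i : ℕ} (hi : i < L.length) :
    L.getD i 0 + i ≤ L.sum := by
  induction L generalizing i with
  | nil => simp at hi
  | cons x L ih =>
    have hx := hL x (by simp)
    have hL' : ∀ y ∈ L, 0 < y := fun y hy => hL y (by simp [hy])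
    cases i with
    | zero => simp
    | succ i =>
      have := ih hL' (by simpa using hi)
      simp only [List.getD_cons_succ, List.sum_cons]
      omega

lemma List.sum_range_getD (L : List ℕ) {n : ℕ} (hn : L.length ≤ n) :
    ∑ i ∈ Finset.range n, L.getD i 0 = L.sum := by
  induction L generalizing n with
  | nil => simp
  | cons x L ih =>
    cases n with
    | zero => simp at hn
    | succ n =>
      rw [Finset.sum_range_succ']
      simp only [List.getD_cons_succ, List.getD_cons_zero, List.sum_cons]
      rw [ih (by simpa using hn), add_comm]

lemma List.length_le_sum_of_pos {L : List ℕ} (hL : ∀ x ∈ L, 0 < x) : L.length ≤ L.sum :=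
  L.length_le_sum_of_one_le hL

lemma dataCode_of_add_lt {n : ℕ} {L : List ℕ} {a b i : ℕ} (hi : i + a + b < n) :
    dataCode n L a b i = L.getD i 0 := by
  simp [dataCode, hi]

lemma dataCode_of_length_le {n : ℕ} {L : List ℕ} {a b i : ℕ} (hi : L.length ≤ i) :
    dataCode n L a b i = if n ≤ i + a + b ∧ i + a < n then a else 0 := by
  simp [dataCode, hi]

lemma sum_dataCode {n : ℕ} {L : List ℕ} {a b : ℕ} (hL : L.length ≤ n) (hab : a + b ≤ n) :
    ∑ j ∈ range n, dataCode n L a b j = L.sum + a * b := by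
  simp only [dataCode]
  rw [sum_add_distrib, L.sum_range_getD hL, ← sum_filter, sum_const, smul_eq_mul, mul_comm a b]
  have : ({j ∈ range n | n ≤ j + a + b ∧ j + a < n} : Finset ℕ) = Ico (n - a - b) (n - a) := by
    ext j
    simp only [mem_filter, mem_range, mem_Ico]
    omega
  rw [this, Nat.card_Ico]
  congr 2
  omega

namespace IsCodeData

variable {k n : ℕ} {L : List ℕ} {a b : ℕ}

lemma add_le (h : IsCodeData k L a b) : L.sum + a + b ≤ k + 1 := by
  have h1 := h.sum_eq
  rcases Nat.eq_zero_or_pos a with ha | ha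
  · have hb := h.zero_iff.1 ha
    subst ha hb
    omega
  · have hb : 0 < b := Nat.pos_of_ne_zero fun hb => ha.ne' (h.zero_iff.2 hb)
    nlinarith

lemma length_add_lt (h : IsCodeData k L a b) (hn : k + 2 ≤ n) : L.length + a + b < n := by
  have := h.add_le
  have := List.length_le_sum_of_pos h.pos
  omega

lemma add_dataCode_lt (h : IsCodeData k L a b) (hn : k + 2 ≤ n) {i : ℕ} (hi : i < n) :
    i + dataCode n L a b i < n := by
  have h1 := h.add_le
  have h2 := h.length_add_lt hn
  rcases lt_or_ge i L.length with hl | hl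
  · rw [dataCode_of_add_lt (by omega)]
    have := List.getD_add_le_sum h.pos hl
    omega
  · rw [dataCode_of_length_le hl]
    split_ifs <;> omega

lemma isShape (h : IsCodeData k L a b) (hn : k + 2 ≤ n) :
    IsShape (fun i : Fin n => dataCode n L a b i) a b := by
  have h1 := h.length_add_lt hn
  refine ⟨by omega, ?_, ?_, ?_⟩
  · intro i j hij hj
    have hij' : (i : ℕ) < j := hij
    simp only
    rw [dataCode_of_add_lt hj, dataCode_of_add_lt (by omega)]
    rcases lt_or_ge (j : ℕ) L.length with hl | hl
    · rw [List.getD_eq_getElem _ _ hl, List.getD_eq_getElem _ _ (hij'.trans hl)]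
      exact List.pairwise_iff_getElem.1 h.sorted _ _ _ hl hij'
    · rw [List.getD_eq_default _ _ hl]
      exact Nat.zero_le _
  · intro i hi hia
    simp only
    rw [dataCode_of_length_le (by omega), if_pos ⟨hi, hia⟩]
  · intro i hi
    simp only
    rw [dataCode_of_length_le (by omega), if_neg (by omega)]

lemma getD_pos (h : IsCodeData k L a b) {i : ℕ} (hi : i < L.length) : 0 < L.getD i 0 := by
  rw [List.getD_eq_getElem _ _ hi]
  exact h.pos _ (List.getElem_mem hi)

variable {L' : List ℕ} {a' b' : ℕ}

lemma length_le_of_dataCode_eq (h : IsCodeData k L a b) (h' : IsCodeData k L' a' b')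
    (hn : k + 2 ≤ n) (heq : ∀ i < n, dataCode n L a b i = dataCode n L' a' b' i) :
    L.length ≤ L'.length := by
  by_contra! hlt
  have h1 := h.length_add_lt hn
  have h1' := h'.length_add_lt hn
  have h2 := heq L'.length (by omega)
  rw [dataCode_of_add_lt (by omega), dataCode_of_add_lt h1', List.getD_eq_default _ _ le_rfl]
    at h2
  exact (h.getD_pos hlt).ne' h2

lemma le_of_dataCode_eq (h : IsCodeData k L a b) (hn : k + 2 ≤ n)
    (hL : L.length = L'.length)
    (heq : ∀ i < n, dataCode n L a b i = dataCode n L' a' b' i) (hb : 0 < b) :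
    a = a' ∧ b ≤ b' := by
  have h1 := h.length_add_lt hn
  have ha : a ≠ 0 := fun ha => hb.ne' (h.zero_iff.1 ha)
  have h2 := heq (n - a - 1) (by omega)
  have h3 := heq (n - a - b) (by omega)
  rw [dataCode_of_length_le (by omega), dataCode_of_length_le (by omega), if_pos (by omega)]
    at h2 h3
  split_ifs at h2 h3 <;> omega

lemma eq_of_dataCode_eq (h : IsCodeData k L a b) (h' : IsCodeData k L' a' b') (hn : k + 2 ≤ n)
    (heq : ∀ i < n, dataCode n L a b i = dataCode n L' a' b' i) : L = L' ∧ a = a' ∧ b = b' := by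
  have heq' : ∀ i < n, dataCode n L' a' b' i = dataCode n L a b i :=
    fun i hi => (heq i hi).symm
  have hL : L.length = L'.length := le_antisymm (h.length_le_of_dataCode_eq h' hn heq)
    (h'.length_le_of_dataCode_eq h hn heq')
  have h1 := h.length_add_lt hn
  have h1' := h'.length_add_lt hn
  refine ⟨List.ext_getElem hL fun i hi hi' => ?_, ?_⟩
  · have h2 := heq i (by omega)
    rwa [dataCode_of_add_lt (by omega), dataCode_of_add_lt (by omega),
      List.getD_eq_getElem _ _ hi, List.getD_eq_getElem _ _ hi'] at h2
  · have h2 := h.le_of_dataCode_eq hn hL heq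
    have h2' := h'.le_of_dataCode_eq hn hL.symm heq'
    have h3 := h.zero_iff
    have h3' := h'.zero_iff
    omega

end IsCodeData

/-- Every sequence of the right shape comes from code data. -/
lemma IsShape.exists_isCodeData {n a b : ℕ} {c : Fin n → ℕ} (h : IsShape c a b)
    (hab : a = 0 ↔ b = 0) :
    ∃ L, IsCodeData (∑ i, c i) L a b ∧ ∀ i : Fin n, c i = dataCode n L a b i := by
  obtain ⟨hn, hanti, hmid, hend⟩ := h
  let c' : ℕ → ℕ := fun i => if hi : i < n then c ⟨i, hi⟩ else 0
  have hc' : ∀ i : Fin n, c' i = c i := fun i => by simp [c']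
  have hanti' : ∀ i j, i < j → j + a + b < n → c' j ≤ c' i := fun i j hij hj => by
    have := hanti ⟨i, by omega⟩ ⟨j, by omega⟩ hij hj
    rwa [← hc', ← hc'] at this
  obtain ⟨z, hz, hpos, hzero⟩ : ∃ z, z ≤ n - a - b ∧ (∀ i < z, c' i ≠ 0) ∧
      ∀ i, z ≤ i → i < n - a - b → c' i = 0 := by
    by_cases hex : ∃ z, z < n - a - b ∧ c' z = 0
    · refine ⟨Nat.find hex, (Nat.find_spec hex).1.le, fun i hi h0 => ?_, fun i hi hin => ?_⟩
      · exact Nat.find_min hex hi ⟨hi.trans (Nat.find_spec hex).1, h0⟩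
      · rcases hi.eq_or_lt with rfl | hi
        · exact (Nat.find_spec hex).2
        · have := hanti' _ _ hi (by omega)
          rw [(Nat.find_spec hex).2] at this
          omega
    · push Not at hex
      exact ⟨n - a - b, le_rfl, hex, fun i h1 h2 => by omega⟩
  let L := (List.range z).map c'
  have hlen : L.length = z := by simp [L]
  have hcode : ∀ i : Fin n, c i = dataCode n L a b i := by
    intro i
    have hi := i.2
    rw [dataCode]
    rcases lt_or_ge (i : ℕ) z with hiz | hiz
    · rw [if_neg (by omega), List.getD_eq_getElem _ _ (by omega)]
      simp [L, hc']
    · rw [List.getD_eq_default _ _ (by omega), zero_add]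
      split_ifs with hif
      · exact hmid i hif.1 hif.2
      · rcases lt_or_ge (i : ℕ) (n - a - b) with hin | hin
        · rw [← hc', hzero i hiz hin]
        · exact hend i (by omega)
  refine ⟨L, ⟨?_, ?_, hab, ?_⟩, hcode⟩
  · rw [List.pairwise_iff_getElem]
    intro i j hi hj hij
    simp only [L, List.getElem_map, List.getElem_range]
    exact hanti' i j hij (by omega)
  · intro x hx
    obtain ⟨i, hi, rfl⟩ := List.mem_map.1 hx
    exact Nat.pos_of_ne_zero (hpos i (List.mem_range.1 hi))
  · rw [sum_congr rfl fun i _ => hcode i, Fin.sum_univ_eq_sum_range (dataCode n L a b),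
      sum_dataCode (by omega) (by omega)]

end Data

/-- The pairs counted by the theorem, fibered over the size of the first partition. -/
abbrev PartitionPair (k : ℕ) : Type :=
  Σ i : Fin (k + 1), Nat.Partition i ×
    {μ : Nat.Partition (k - i) // ∀ x ∈ μ.parts, ∀ y ∈ μ.parts, x = y}

namespace PartitionPair

variable {k : ℕ}

/-- The first partition, in weakly decreasing order. -/
def list (x : PartitionPair k) : List ℕ := x.2.1.parts.sort (· ≥ ·)

/-- The common value of the parts of the second partition. -/
def part (x : PartitionPair k) : ℕ := x.2.2.1.parts.sup

/-- The number of parts of the second partition. -/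
def mult (x : PartitionPair k) : ℕ := Multiset.card x.2.2.1.parts

lemma parts_eq_replicate (x : PartitionPair k) :
    x.2.2.1.parts = Multiset.replicate x.mult x.part := by
  refine Multiset.eq_replicate.2 ⟨rfl, fun y hy => ?_⟩
  refine le_antisymm (Multiset.le_sup hy) (Multiset.sup_le.2 fun z hz => ?_)
  exact (x.2.2.2 z hz y hy).le

lemma coe_list (x : PartitionPair k) : (x.list : Multiset ℕ) = x.2.1.parts :=
  Multiset.sort_eq _ _

lemma isCodeData (x : PartitionPair k) : IsCodeData k x.list x.part x.mult where
  sorted := Multiset.pairwise_sort _ _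
  pos y hy := x.2.1.parts_pos (by rwa [← coe_list, Multiset.mem_coe])
  zero_iff := by
    constructor
    · intro h
      by_contra h'
      obtain ⟨y, hy⟩ := Multiset.card_pos_iff_exists_mem.1 (Nat.pos_of_ne_zero h')
      have h1 := x.2.2.1.parts_pos hy
      have h2 : y ≤ x.part := Multiset.le_sup hy
      omega
    · intro h
      rw [part, Multiset.card_eq_zero.1 h]
      rfl
  sum_eq := by
    have h1 : x.list.sum = x.1 := by
      rw [← Multiset.sum_coe, coe_list, x.2.1.parts_sum]
    have h2 : x.part * x.mult = k - x.1 := by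
      rw [← x.2.2.1.parts_sum, parts_eq_replicate, Multiset.sum_replicate, smul_eq_mul, mul_comm]
    have := x.1.2
    omega

lemma ext_data {x y : PartitionPair k} (hl : x.list = y.list) (hp : x.part = y.part)
    (hm : x.mult = y.mult) : x = y := by
  have h1 : x.2.1.parts = y.2.1.parts := by rw [← coe_list, ← coe_list, hl]
  have h2 : x.2.2.1.parts = y.2.2.1.parts := by
    rw [parts_eq_replicate, parts_eq_replicate, hp, hm]
  obtain ⟨i, l, m, hm⟩ := x
  obtain ⟨j, l', m', hm'⟩ := y
  obtain rfl : i = j := by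
    rw [Fin.ext_iff, ← l.parts_sum, ← l'.parts_sum]
    exact congrArg _ h1
  obtain rfl : l = l' := Nat.Partition.ext h1
  obtain rfl : m = m' := Nat.Partition.ext h2
  rfl

lemma exists_of_isCodeData {L : List ℕ} {a b : ℕ} (h : IsCodeData k L a b) :
    ∃ x : PartitionPair k, x.list = L ∧ x.part = a ∧ x.mult = b := by
  have hsum := h.sum_eq
  refine ⟨⟨⟨L.sum, by omega⟩, ⟨(L : Multiset ℕ), fun hi => h.pos _ hi, Multiset.sum_coe L⟩,
    ⟨⟨Multiset.replicate b a, fun {i} hi => ?_, ?_⟩, ?_⟩⟩, ?_, ?_, ?_⟩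
  · obtain ⟨hb, rfl⟩ := Multiset.mem_replicate.1 hi
    exact Nat.pos_of_ne_zero (mt h.zero_iff.1 hb)
  · rw [Multiset.sum_replicate, smul_eq_mul, mul_comm]
    simp only
    omega
  · intro x hx y hy
    rw [Multiset.eq_of_mem_replicate hx, Multiset.eq_of_mem_replicate hy]
  · simp only [list, Multiset.coe_sort]
    exact List.mergeSort_of_pairwise (h.sorted.imp fun hxy => by simpa using hxy)
  · simp only [part]
    rcases Nat.eq_zero_or_pos b with rfl | hb
    · rw [h.zero_iff.2 rfl]
      rfl
    · refine le_antisymm (Multiset.sup_le.2 fun z hz => (Multiset.eq_of_mem_replicate hz).le)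
        (Multiset.le_sup (Multiset.mem_replicate.2 ⟨hb.ne', rfl⟩))
  · simp [mult]

lemma card_eq (k : ℕ) : Nat.card (PartitionPair k) = ∑ i ∈ range (k + 1),
    Nat.card (Nat.Partition i) *
      Nat.card {μ : Nat.Partition (k - i) // ∀ x ∈ μ.parts, ∀ y ∈ μ.parts, x = y} := by
  rw [Nat.card_sigma, sum_range]
  simp only [Nat.card_prod]

end PartitionPair

/-- For every `k ≥ 0` and every `n ≥ k + 2`, the number of permutations of length `n`
with exactly `k` inversions avoiding both 1324 and 1432 equals the number of pairs
`(λ, μ)` of integer partitions with `|λ| + |μ| = k` such that all parts of `μ` are equal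
(`μ` may be empty). -/
theorem av_1324_1432_eq (k n : ℕ) (hn : k + 2 ≤ n) :
    Nat.card {π : Equiv.Perm (Fin n) // invCount π = k ∧
      Avoids π p1324 ∧ Avoids π p1432} =
    ∑ i ∈ Finset.range (k + 1),
      Nat.card (Nat.Partition i) *
        Nat.card {μ : Nat.Partition (k - i) // ∀ x ∈ μ.parts, ∀ y ∈ μ.parts, x = y} := by
  rw [← PartitionPair.card_eq]
  have hex : ∀ x : PartitionPair k, ∃ π : Equiv.Perm (Fin n),
      lehmer π = fun i : Fin n => dataCode n x.list x.part x.mult i :=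
    fun x => exists_lehmer_eq _ fun i => x.isCodeData.add_dataCode_lt hn i.2
  choose F hF using hex
  have hgood : ∀ x, invCount (F x) = k ∧ Avoids (F x) p1324 ∧ Avoids (F x) p1432 := by
    intro x
    have hx := x.isCodeData.length_add_lt hn
    refine ⟨?_, avoids_of_isShape (hF x ▸ x.isCodeData.isShape hn)⟩
    rw [invCount_eq_sum_lehmer, hF x, Fin.sum_univ_eq_sum_range (dataCode n x.list x.part x.mult),
      sum_dataCode (by omega) (by omega), x.isCodeData.sum_eq]
  refine (Nat.card_congr (Equiv.ofBijective (fun x => ⟨F x, hgood x⟩) ⟨?_, ?_⟩)).symm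
  · intro x y hxy
    have hF' : F x = F y := congrArg Subtype.val hxy
    have heq : ∀ i < n, dataCode n x.list x.part x.mult i =
        dataCode n y.list y.part y.mult i := by
      intro i hi
      have := congrFun (hF x ▸ hF y ▸ congrArg lehmer hF') ⟨i, hi⟩
      exact this
    obtain ⟨hl, hp, hm⟩ := x.isCodeData.eq_of_dataCode_eq y.isCodeData hn heq
    exact PartitionPair.ext_data hl hp hm
  · rintro ⟨π, hk, h1, h2⟩
    obtain ⟨a, b, hab, hshape⟩ := exists_isShape (by omega) h1 h2
    obtain ⟨L, hL, hcode⟩ := hshape.exists_isCodeData hab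
    rw [← invCount_eq_sum_lehmer, hk] at hL
    obtain ⟨x, rfl, rfl, rfl⟩ := PartitionPair.exists_of_isCodeData hL
    refine ⟨x, Subtype.ext (lehmer_injective ?_)⟩
    rw [hF x]
    exact funext fun i => (hcode i).symm
end
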